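/- Let (Xᵢ)ᵢ≥₁ be i.i.d. real random variables with E[X₁]=0 and 0<Var(X₁)<∞, and set S₀=0, Sₙ:=X₁+⋯+Xₙ and Lₙ⁻:=min{0,S₁,…,Sₙ}. Then for every θ>1 one has E[e^{−Sₙ+θLₙ⁻}] = O(n^{−3/2}) as n→∞. -/

import Mathlib

open MeasureTheory ProbabilityTheory Filter Topology Asymptotics

namespace SpW
open scoped Measure

lemma integrable_cf (μ : Measure ℝ) [IsFiniteMeasure μ] (t : ℝ) :
    Integrable (fun x : ℝ => Complex.exp (t * x * Complex.I)) μ := by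
  refine Integrable.of_bound (C := 1) (by fun_prop) (ae_of_all _ fun x => ?_)
  have := Complex.norm_exp_ofReal_mul_I (t * x)
  push_cast at this
  exact this.le

lemma charFun_add' (μ ν : Measure ℝ) [IsFiniteMeasure μ] [IsFiniteMeasure ν] (t : ℝ) :
    charFun (μ + ν) t = charFun μ t + charFun ν t := by
  simp only [charFun_apply_real]
  exact integral_add_measure (integrable_cf μ t) (integrable_cf ν t)

lemma charFun_sum' {ι : Type*} (s : Finset ι) (m : ι → Measure ℝ) [∀ i, IsFiniteMeasure (m i)]
    (t : ℝ) : charFun (∑ i ∈ s, m i) t = ∑ i ∈ s, charFun (m i) t := by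
  classical
  induction s using Finset.induction_on with
  | empty => simp
  | insert a s ha ih => rw [Finset.sum_insert ha, Finset.sum_insert ha, charFun_add', ih]

lemma charFun_nsmul' (n : ℕ) (μ : Measure ℝ) [IsFiniteMeasure μ] (t : ℝ) :
    charFun (n • μ) t = n * charFun μ t := by
  have := charFun_sum' (Finset.range n) (fun _ => μ) t
  simpa using this

lemma charFun_split (μ : Measure ℝ) [IsFiniteMeasure μ] (t : ℝ) :
    charFun (μ.restrict (Set.Iic 0)) t + charFun (μ.restrict (Set.Ioi 0)) t = charFun μ t := by
  rw [← charFun_add']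
  congr 1
  rw [← Set.compl_Iic]
  exact Measure.restrict_add_restrict_compl measurableSet_Iic

/-- φ is the char. function of a finite measure carried by `s`. -/
def SuppF (s : Set ℝ) (φ : ℝ → ℂ) : Prop :=
  ∃ μ : Measure ℝ, IsFiniteMeasure μ ∧ μ sᶜ = 0 ∧ ∀ t, charFun μ t = φ t

lemma SuppF.zero (s : Set ℝ) : SuppF s (fun _ => 0) :=
  ⟨0, inferInstance, by simp, by simp⟩

lemma SuppF.add {s : Set ℝ} {φ ψ : ℝ → ℂ} (h1 : SuppF s φ) (h2 : SuppF s ψ) :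
    SuppF s (fun t => φ t + ψ t) := by
  obtain ⟨μ, _, h, h'⟩ := h1
  obtain ⟨ν, _, k, k'⟩ := h2
  exact ⟨μ + ν, inferInstance, by simp [h, k], fun t => by rw [charFun_add', h', k']⟩

lemma SuppF.sum {ι : Type*} (I : Finset ι) {s : Set ℝ} {φ : ι → ℝ → ℂ}
    (h : ∀ i ∈ I, SuppF s (φ i)) : SuppF s (fun t => ∑ i ∈ I, φ i t) := by
  classical
  induction I using Finset.induction_on with
  | empty => simpa using SuppF.zero s
  | insert a J ha ih =>
    simp only [Finset.sum_insert ha]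
    exact (h a (by simp)).add (ih fun i hi => h i (by simp [hi]))

lemma SuppF.nmul {s : Set ℝ} {φ : ℝ → ℂ} (n : ℕ) (h : SuppF s φ) :
    SuppF s (fun t => n * φ t) := by
  simpa using SuppF.sum (Finset.range n) (φ := fun _ => φ) (fun _ _ => h)

lemma SuppF.mul {s s' r : Set ℝ} {φ ψ : ℝ → ℂ} (hr : MeasurableSet r)
    (hs : ∀ x ∈ s, ∀ y ∈ s', x + y ∈ r) (h1 : SuppF s φ) (h2 : SuppF s' ψ) :
    SuppF r (fun t => φ t * ψ t) := by
  obtain ⟨μ, _, h, h'⟩ := h1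
  obtain ⟨ν, _, k, k'⟩ := h2
  refine ⟨μ ∗ ν, inferInstance, ?_, fun t => by rw [charFun_conv, h', k']⟩
  rw [Measure.conv, Measure.map_apply (by fun_prop) hr.compl]
  refine measure_mono_null (t := (sᶜ ×ˢ Set.univ) ∪ (Set.univ ×ˢ s'ᶜ)) ?_ ?_
  · rintro ⟨x, y⟩ hxy
    by_contra hc
    simp at hc
    exact hxy (hs x hc.1 y hc.2)
  · refine measure_union_null ?_ ?_ <;> simp [Measure.prod_prod, h, k]

lemma SuppF.mono {s r : Set ℝ} {φ : ℝ → ℂ} (hs : s ⊆ r) (h1 : SuppF s φ) : SuppF r φ := by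
  obtain ⟨μ, i, h, h'⟩ := h1
  exact ⟨μ, i, measure_mono_null (Set.compl_subset_compl.2 hs) h, h'⟩

lemma SuppF.restrict (μ : Measure ℝ) [IsFiniteMeasure μ] {s : Set ℝ} (hs : MeasurableSet s) :
    SuppF s (charFun (μ.restrict s)) :=
  ⟨_, inferInstance, by simp [Measure.restrict_apply hs.compl], fun _ => rfl⟩

lemma supp_split {f1 f2 g1 g2 : ℝ → ℂ} (hf1 : SuppF (Set.Iic 0) f1) (hf2 : SuppF (Set.Iic 0) f2)
    (hg1 : SuppF (Set.Ioi 0) g1) (hg2 : SuppF (Set.Ioi 0) g2)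
    (h : ∀ t, f1 t + g1 t = f2 t + g2 t) : ∀ t, f1 t = f2 t := by
  obtain ⟨a1, _, ha1, ha1'⟩ := hf1
  obtain ⟨a2, _, ha2, ha2'⟩ := hf2
  obtain ⟨b1, _, hb1, hb1'⟩ := hg1
  obtain ⟨b2, _, hb2, hb2'⟩ := hg2
  have key : a1 + b1 = a2 + b2 := by
    apply Measure.ext_of_charFun
    funext t
    rw [charFun_add', charFun_add', ha1', ha2', hb1', hb2', h]
  have r (a : Measure ℝ) (ha : a (Set.Iic 0)ᶜ = 0) : a.restrict (Set.Iic 0) = a :=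
    Measure.restrict_eq_self_of_ae_mem (mem_ae_iff.2 ha)
  have r' (a : Measure ℝ) (ha : a (Set.Ioi 0)ᶜ = 0) : a.restrict (Set.Iic 0) = 0 := by
    rw [Measure.restrict_eq_zero]
    simpa using ha
  have := congrArg (fun m => m.restrict (Set.Iic (0:ℝ))) key
  simp only [Measure.restrict_add, r a1 ha1, r a2 ha2, r' b1 hb1, r' b2 hb2, add_zero] at this
  intro t
  rw [← ha1', ← ha2', this]

variable (F : Measure ℝ)

noncomputable def uM : ℕ → Measure ℝ
  | 0 => Measure.dirac 0
  | n + 1 => (uM n ∗ F).restrict (Set.Iic 0)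

noncomputable def vM : ℕ → Measure ℝ
  | 0 => Measure.dirac 0
  | n + 1 => (vM n ∗ F).restrict (Set.Ioi 0)

noncomputable def gM : ℕ → Measure ℝ
  | 0 => 0
  | n + 1 => (vM F n ∗ F).restrict (Set.Iic 0)

noncomputable def hM : ℕ → Measure ℝ
  | 0 => 0
  | n + 1 => (uM F n ∗ F).restrict (Set.Ioi 0)

noncomputable def FM : ℕ → Measure ℝ
  | 0 => Measure.dirac 0
  | n + 1 => FM n ∗ F

noncomputable def qM : ℕ → Measure ℝ
  | 0 => 0
  | n + 1 => (FM F (n+1)).restrict (Set.Iic 0)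

noncomputable def pM : ℕ → Measure ℝ
  | 0 => 0
  | n + 1 => (FM F (n+1)).restrict (Set.Ioi 0)

variable [IsFiniteMeasure F]

instance (n : ℕ) : IsFiniteMeasure (uM F n) := by
  induction n with
  | zero => unfold uM; infer_instance
  | succ n ih => unfold uM; infer_instance

instance (n : ℕ) : IsFiniteMeasure (vM F n) := by
  induction n with
  | zero => unfold vM; infer_instance
  | succ n ih => unfold vM; infer_instance

instance (n : ℕ) : IsFiniteMeasure (FM F n) := by
  induction n with
  | zero => unfold FM; infer_instance
  | succ n ih => unfold FM; infer_instance

instance (n : ℕ) : IsFiniteMeasure (gM F n) := by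
  cases n <;> unfold gM <;> infer_instance

instance (n : ℕ) : IsFiniteMeasure (hM F n) := by
  cases n <;> unfold hM <;> infer_instance

instance (n : ℕ) : IsFiniteMeasure (pM F n) := by
  cases n <;> unfold pM <;> infer_instance

instance (n : ℕ) : IsFiniteMeasure (qM F n) := by
  cases n <;> unfold qM <;> infer_instance

lemma supp_u (n : ℕ) : SuppF (Set.Iic 0) (charFun (uM F n)) := by
  cases n with
  | zero => exact ⟨uM F 0, inferInstance, by simp [uM], fun _ => rfl⟩
  | succ n => exact SuppF.restrict _ measurableSet_Iic

lemma supp_v_succ (n : ℕ) : SuppF (Set.Ioi 0) (charFun (vM F (n+1))) :=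
  SuppF.restrict _ measurableSet_Ioi

lemma supp_v (n : ℕ) : SuppF (Set.Ici 0) (charFun (vM F n)) := by
  cases n with
  | zero => exact ⟨vM F 0, inferInstance, by simp [vM], fun _ => rfl⟩
  | succ n => exact (supp_v_succ F n).mono Set.Ioi_subset_Ici_self

lemma supp_g (n : ℕ) : SuppF (Set.Iic 0) (charFun (gM F n)) := by
  cases n with
  | zero => exact ⟨gM F 0, inferInstance, by simp [gM], fun _ => rfl⟩
  | succ n => exact SuppF.restrict _ measurableSet_Iic

lemma supp_h (n : ℕ) : SuppF (Set.Ioi 0) (charFun (hM F n)) := by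
  cases n with
  | zero => exact ⟨hM F 0, inferInstance, by simp [hM], fun _ => rfl⟩
  | succ n => exact SuppF.restrict _ measurableSet_Ioi

lemma supp_q (n : ℕ) : SuppF (Set.Iic 0) (charFun (qM F n)) := by
  cases n with
  | zero => exact ⟨qM F 0, inferInstance, by simp [qM], fun _ => rfl⟩
  | succ n => exact SuppF.restrict _ measurableSet_Iic

lemma supp_p (n : ℕ) : SuppF (Set.Ioi 0) (charFun (pM F n)) := by
  cases n with
  | zero => exact ⟨pM F 0, inferInstance, by simp [pM], fun _ => rfl⟩
  | succ n => exact SuppF.restrict _ measurableSet_Ioi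

/-- generating series -/
noncomputable def gs (m : ℕ → Measure ℝ) (t : ℝ) : PowerSeries ℂ :=
  PowerSeries.mk fun n => charFun (m n) t

@[simp] lemma coeff_gs (m : ℕ → Measure ℝ) (t : ℝ) (n : ℕ) :
    PowerSeries.coeff n (gs m t) = charFun (m n) t := by simp [gs]

@[simp] lemma ccoeff_gs (m : ℕ → Measure ℝ) (t : ℝ) :
    PowerSeries.constantCoeff (gs m t) = charFun (m 0) t := by
  rw [← PowerSeries.coeff_zero_eq_constantCoeff_apply, coeff_gs]

open PowerSeries in
lemma gs_V (t : ℝ) : gs (vM F) t + gs (gM F) t = 1 + C (charFun F t) * (X * gs (vM F) t) := by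
  ext n
  cases n with
  | zero => simp [vM, gM]
  | succ n =>
    simp [coeff_succ_X_mul, coeff_one, vM, gM]
    rw [add_comm, charFun_split, charFun_conv, mul_comm]

open PowerSeries in
lemma gs_U (t : ℝ) : gs (uM F) t + gs (hM F) t = 1 + C (charFun F t) * (X * gs (uM F) t) := by
  ext n
  cases n with
  | zero => simp [uM, hM]
  | succ n =>
    simp [coeff_succ_X_mul, coeff_one, uM, hM]
    rw [charFun_split, charFun_conv, mul_comm]

open PowerSeries in
lemma gs_E (t : ℝ) : gs (FM F) t = 1 + C (charFun F t) * (X * gs (FM F) t) := by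
  ext n
  cases n with
  | zero => simp [FM]
  | succ n =>
    simp [coeff_succ_X_mul, coeff_one, FM]
    rw [charFun_conv, mul_comm]

open PowerSeries in
lemma gs_PQ (t : ℝ) : gs (qM F) t + gs (pM F) t + 1 = gs (FM F) t := by
  ext n
  cases n with
  | zero => simp [FM, qM, pM]
  | succ n =>
    simp [coeff_one, qM, pM]
    rw [charFun_split]

open PowerSeries in
lemma coeff_UG (n : ℕ) (t : ℝ) :
    charFun (uM F (n+1)) t = coeff (n+1) (gs (uM F) t * gs (gM F) t) := by
  refine supp_split (g1 := fun t => coeff (n+1) (gs (vM F) t * gs (hM F) t))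
    (g2 := fun t => charFun (vM F (n+1)) t) (supp_u F _)
    (f2 := fun t => coeff (n+1) (gs (uM F) t * gs (gM F) t)) ?_ ?_ (supp_v_succ F n) ?_ t
  · simp only [coeff_mul, coeff_gs]
    refine SuppF.sum _ fun p _ => SuppF.mul measurableSet_Iic ?_ (supp_u F _) (supp_g F _)
    simp; intros; linarith
  · simp only [coeff_mul, coeff_gs]
    refine SuppF.sum _ fun p _ => SuppF.mul measurableSet_Ioi ?_ (supp_v F _) (supp_h F _)
    simp; intros; linarith
  · intro t
    have h1 := gs_V F t
    have h2 := gs_U F t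
    have : gs (uM F) t + gs (vM F) t * gs (hM F) t = gs (uM F) t * gs (gM F) t + gs (vM F) t := by
      linear_combination (gs (vM F) t) * h2 - gs (uM F) t * h1
    simpa using congrArg (coeff (n+1)) this

open PowerSeries in
lemma gs_UG (t : ℝ) : gs (uM F) t = 1 + gs (uM F) t * gs (gM F) t := by
  ext n
  cases n with
  | zero => simp [uM, gM]
  | succ n => simp [coeff_one, ← coeff_UG]

lemma gs_UV (t : ℝ) : gs (uM F) t * gs (vM F) t = gs (FM F) t := by
  have h1 := gs_V F t
  have h2 := gs_UG F t
  have h3 := gs_E F t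
  linear_combination (-gs (uM F) t * gs (vM F) t) * h3 + (gs (FM F) t * gs (uM F) t) * h1 +  gs (FM F) t * h2

open PowerSeries in
lemma rec_aux (n : ℕ) : ∀ t, (coeff n (X * derivative ℂ (gs (uM F) t)) =
      coeff n (gs (qM F) t * gs (uM F) t)) ∧ (coeff n (X * derivative ℂ (gs (vM F) t)) =
      coeff n (gs (pM F) t * gs (vM F) t)) := by
  induction n using Nat.strong_induction_on with
  | _ n ih =>
  cases n with
  | zero => intro t; simp [qM, pM]
  | succ n =>
  have key : ∀ t, coeff (n+1) (X * derivative ℂ (gs (uM F) t)) +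
      coeff (n+1) (X * derivative ℂ (gs (vM F) t)) = coeff (n+1) (gs (qM F) t * gs (uM F) t)
      + coeff (n+1) (gs (pM F) t * gs (vM F) t) := by
    intro t
    have hE := gs_E F t
    have hUV := gs_UV F t
    have hPQ := gs_PQ F t
    have hd := congrArg (derivative ℂ) hE
    have hd2 := congrArg (derivative ℂ) hUV
    simp only [Derivation.leibniz, map_add, smul_eq_mul, derivative_X, derivative_C, Derivation.map_one_eq_zero] at hd hd2
    have e1 : X * derivative ℂ (gs (FM F) t) = (gs (FM F) t - 1) * gs (FM F) t := by
      linear_combination (gs (FM F) t * X) * hd - X * derivative ℂ (gs (FM F) t) * hE - gs (FM F) t * hE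
    have e2 : (X * derivative ℂ (gs (uM F) t) - gs (qM F) t * gs (uM F) t) * gs (vM F) t +
        gs (uM F) t * (X * derivative ℂ (gs (vM F) t) - gs (pM F) t * gs (vM F) t) = 0 := by
      linear_combination X * hd2 + e1 - (gs (qM F) t + gs (pM F) t) * hUV - gs (FM F) t * hPQ
    have e3 := congrArg (coeff (n+1)) e2
    rw [map_add, coeff_mul, coeff_mul, Finset.Nat.sum_antidiagonal_succ', Finset.sum_eq_zero, Finset.Nat.sum_antidiagonal_succ, Finset.sum_eq_zero] at e3
    · simp [uM, vM] at e3
      simp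
      linear_combination e3
    · intro p hp
      have : p.2 < n + 1 := by
        have := Finset.HasAntidiagonal.mem_antidiagonal.1 hp; omega
      rw [map_sub, (ih p.2 this t).2, sub_self, mul_zero]
    · intro p hp
      have : p.1 < n + 1 := by
        have := Finset.HasAntidiagonal.mem_antidiagonal.1 hp; omega
      rw [map_sub, (ih p.1 this t).1, sub_self, zero_mul]
  have hu : SuppF (Set.Iic 0) fun t => coeff (n+1) (X * derivative ℂ (gs (uM F) t)) := by
    simp only [coeff_succ_X_mul, coeff_derivative, coeff_gs]
    simpa [mul_comm] using (supp_u F (n+1)).nmul (n+1)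
  have hv : SuppF (Set.Ioi 0) fun t => coeff (n+1) (X * derivative ℂ (gs (vM F) t)) := by
    simp only [coeff_succ_X_mul, coeff_derivative, coeff_gs]
    simpa [mul_comm] using (supp_v_succ F n).nmul (n+1)
  have hq : SuppF (Set.Iic 0) fun t => coeff (n+1) (gs (qM F) t * gs (uM F) t) := by
    simp only [coeff_mul, coeff_gs]
    refine SuppF.sum _ fun p _ => SuppF.mul measurableSet_Iic ?_ (supp_q F _) (supp_u F _)
    simp; intros; linarith
  have hp : SuppF (Set.Ioi 0) fun t => coeff (n+1) (gs (pM F) t * gs (vM F) t) := by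
    simp only [coeff_mul, coeff_gs]
    refine SuppF.sum _ fun p _ => SuppF.mul measurableSet_Ioi ?_ (supp_p F _) (supp_v F _)
    simp; intros; linarith
  have r1 := supp_split hu hq hv hp key
  intro t
  refine ⟨r1 t, ?_⟩
  have := key t
  rw [r1 t] at this
  exact add_left_cancel this

open PowerSeries in
lemma rec_u (n : ℕ) : n • uM F n = ∑ p ∈ Finset.HasAntidiagonal.antidiagonal n, qM F p.1 ∗ uM F p.2 := by
  apply Measure.ext_of_charFun
  funext t
  rw [charFun_nsmul', charFun_sum']
  rw [Finset.sum_congr rfl (fun p _ => charFun_conv (μ := qM F p.1) (ν := uM F p.2) t)]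
  have := (rec_aux F n t).1
  rw [coeff_mul _ (gs _ _)] at this
  simp only [coeff_gs] at this
  rw [← this]
  cases n with
  | zero => simp
  | succ n => simp [coeff_succ_X_mul, coeff_derivative, mul_comm]

open PowerSeries in
lemma rec_v (n : ℕ) : n • vM F n = ∑ p ∈ Finset.HasAntidiagonal.antidiagonal n, pM F p.1 ∗ vM F p.2 := by
  apply Measure.ext_of_charFun
  funext t
  rw [charFun_nsmul', charFun_sum']
  rw [Finset.sum_congr rfl (fun p _ => charFun_conv (μ := pM F p.1) (ν := vM F p.2) t)]
  have := (rec_aux F n t).2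
  rw [coeff_mul _ (gs _ _)] at this
  simp only [coeff_gs] at this
  rw [← this]
  cases n with
  | zero => simp
  | succ n => simp [coeff_succ_X_mul, coeff_derivative, mul_comm]

open PowerSeries in
lemma rec_g (n : ℕ) :
    uM F (n+1) = ∑ p ∈ Finset.HasAntidiagonal.antidiagonal n, uM F p.1 ∗ gM F (p.2 + 1) := by
  apply Measure.ext_of_charFun
  funext t
  rw [charFun_sum', coeff_UG, coeff_mul, Finset.Nat.sum_antidiagonal_succ']
  simp [charFun_conv, gM]


lemma elem_ineq {x y ν : ℝ} (hx : 0 < x) (hy : 0 < y) (hν : 0 < ν) (h : ν ≤ x + y) :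
    x ^ (-(1/2) : ℝ) * y ^ (-(5/4) : ℝ) ≤
      2 * ν ^ (-(1/2) : ℝ) * (y ^ (-(5/4) : ℝ) + x ^ (-(5/4) : ℝ)) := by
  have h2 : (ν / 2) ^ (-(1/2) : ℝ) ≤ 2 * ν ^ (-(1/2) : ℝ) := by
    rw [Real.div_rpow hν.le (by norm_num), div_eq_mul_inv, ← Real.rpow_neg (by norm_num), mul_comm]
    gcongr
    calc (2:ℝ) ^ (-(-(1/2)) : ℝ) ≤ 2 ^ (1:ℝ) :=
          Real.rpow_le_rpow_of_exponent_le (by norm_num) (by norm_num)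
      _ = 2 := by simp
  have px := Real.rpow_pos_of_pos hx (-(5/4))
  have py := Real.rpow_pos_of_pos hy (-(5/4))
  have pn := Real.rpow_pos_of_pos hν (-(1/2))
  rcases le_total y x with hc | hc
  · have : x ^ (-(1/2) : ℝ) ≤ (ν / 2) ^ (-(1/2) : ℝ) :=
      Real.rpow_le_rpow_of_nonpos (by positivity) (by linarith) (by norm_num)
    calc _ ≤ (2 * ν ^ (-(1/2) : ℝ)) * y ^ (-(5/4) : ℝ) := by
            gcongr; exact this.trans h2
      _ ≤ _ := by gcongr; linarith
  · have e1 : y ^ (-(1/2) : ℝ) ≤ (ν / 2) ^ (-(1/2) : ℝ) :=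
      Real.rpow_le_rpow_of_nonpos (by positivity) (by linarith) (by norm_num)
    have e2 : y ^ (-(3/4) : ℝ) ≤ x ^ (-(3/4) : ℝ) :=
      Real.rpow_le_rpow_of_nonpos hx hc (by norm_num)
    have e3 : y ^ (-(5/4) : ℝ) = y ^ (-(1/2) : ℝ) * y ^ (-(3/4) : ℝ) := by
      rw [← Real.rpow_add hy]; norm_num
    have e4 : x ^ (-(5/4) : ℝ) = x ^ (-(1/2) : ℝ) * x ^ (-(3/4) : ℝ) := by
      rw [← Real.rpow_add hx]; norm_num
    calc _ ≤ x ^ (-(1/2) : ℝ) * ((2 * ν ^ (-(1/2) : ℝ)) * x ^ (-(3/4) : ℝ)) := by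
            rw [e3]; gcongr; exact e1.trans h2
      _ = (2 * ν ^ (-(1/2) : ℝ)) * x ^ (-(5/4) : ℝ) := by rw [e4]; ring
      _ ≤ _ := by gcongr; linarith

lemma seq_bound (a b : ℕ → ℝ) (C : ℝ) (ha : ∀ n, 0 ≤ a n)
    (hb : ∀ k, b (k+1) ≤ C * ((k:ℝ)+1) ^ (-(1/2) : ℝ)) (hC : 0 ≤ C)
    (hrec : ∀ n : ℕ, ((n:ℝ)+1) * a (n+1) = ∑ k ∈ Finset.range (n+1), b (k+1) * a (n-k)) :
    ∃ K, ∀ n : ℕ, a (n+1) ≤ K * ((n:ℝ)+1) ^ (-(3/2) : ℝ) := by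
  have hs : Summable (fun j : ℕ => ((j:ℝ)+1) ^ (-(5/4) : ℝ)) := by
    have h0 : Summable (fun j : ℕ => (j:ℝ) ^ (-(5/4) : ℝ)) :=
      Real.summable_nat_rpow.2 (by norm_num)
    have := (summable_nat_add_iff 1).2 h0
    simpa using this
  set Z := ∑' j : ℕ, ((j:ℝ)+1) ^ (-(5/4) : ℝ) with hZ
  have hZle : ∀ n, ∑ j ∈ Finset.range n, ((j:ℝ)+1) ^ (-(5/4) : ℝ) ≤ Z := fun n =>
    hs.sum_le_tsum _ fun j _ => by positivity
  have hZ0 : 0 ≤ Z := by simpa using hZle 0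
  set M := 4 * C * Z with hM
  have hM0 : 0 ≤ M := by positivity
  have key : ∀ n : ℕ, ∀ K : ℝ, 0 ≤ K → (∀ m ≤ n, a m ≤ K * ((m:ℝ)+1) ^ (-(5/4) : ℝ)) →
      a (n+1) ≤ M * K * ((n:ℝ)+1) ^ (-(3/2) : ℝ) := by
    intro n K hK h
    have hn : (0:ℝ) < (n:ℝ) + 1 := by positivity
    have s1 : ((n:ℝ)+1) * a (n+1) ≤ M * K * ((n:ℝ)+1) ^ (-(1/2) : ℝ) := by
      rw [hrec]
      calc _ ≤ ∑ k ∈ Finset.range (n+1), (2 * C * K * ((n:ℝ)+1) ^ (-(1/2) : ℝ)) *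
              ((((n - k : ℕ):ℝ)+1) ^ (-(5/4) : ℝ) + ((k:ℝ)+1) ^ (-(5/4) : ℝ)) := by
            refine Finset.sum_le_sum fun k hk => ?_
            have hkn : k ≤ n := by simpa [Nat.lt_succ_iff] using hk
            have := elem_ineq (x := (k:ℝ)+1) (y := ((n-k : ℕ):ℝ)+1) (ν := (n:ℝ)+1)
              (by positivity) (by positivity) hn (by rw [Nat.cast_sub hkn]; linarith)
            calc b (k+1) * a (n-k) ≤ (C * ((k:ℝ)+1) ^ (-(1/2) : ℝ)) *
                  (K * (((n - k : ℕ):ℝ)+1) ^ (-(5/4) : ℝ)) :=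
                  mul_le_mul (hb k) (h _ (Nat.sub_le _ _)) (ha _) (by positivity)
              _ = C * K * (((k:ℝ)+1) ^ (-(1/2) : ℝ) * (((n - k : ℕ):ℝ)+1) ^ (-(5/4) : ℝ)) := by ring
              _ ≤ C * K * _ := mul_le_mul_of_nonneg_left this (by positivity)
              _ = _ := by ring
        _ = (2 * C * K * ((n:ℝ)+1) ^ (-(1/2) : ℝ)) *
              (∑ j ∈ Finset.range (n+1), ((j:ℝ)+1) ^ (-(5/4) : ℝ) +
               ∑ j ∈ Finset.range (n+1), ((j:ℝ)+1) ^ (-(5/4) : ℝ)) := by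
            rw [← Finset.mul_sum, Finset.sum_add_distrib]
            congr 2
            have := Finset.sum_range_reflect (fun j : ℕ => ((j:ℝ)+1) ^ (-(5/4) : ℝ)) (n+1)
            simpa using this
        _ ≤ (2 * C * K * ((n:ℝ)+1) ^ (-(1/2) : ℝ)) * (Z + Z) := by
            gcongr <;> exact hZle _
        _ = _ := by rw [hM]; ring
    have e : ((n:ℝ)+1) ^ (-(1/2) : ℝ) = ((n:ℝ)+1) * ((n:ℝ)+1) ^ (-(3/2) : ℝ) := by
      conv_rhs => rw [← Real.rpow_one_add' hn.le (by norm_num)]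
      norm_num
    rw [e] at s1
    refine le_of_mul_le_mul_left ?_ hn
    linarith
  have hN : ∃ N : ℕ, ∀ n ≥ N, 4 * M ≤ ((n:ℝ)+1) ^ ((1/4) : ℝ) := by
    have h1 : Tendsto (fun n : ℕ => ((n:ℝ)+1) ^ ((1/4) : ℝ)) atTop atTop :=
      (tendsto_rpow_atTop (by norm_num)).comp
        (tendsto_atTop_add_const_right _ _ tendsto_natCast_atTop_atTop)
    exact eventually_atTop.1 (h1.eventually_ge_atTop (4 * M))
  obtain ⟨N, hN⟩ := hN
  set K := ∑ m ∈ Finset.range (N+1), a m * ((m:ℝ)+1) ^ ((5/4) : ℝ) with hK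
  have hK0 : 0 ≤ K := Finset.sum_nonneg fun m _ => mul_nonneg (ha m) (by positivity)
  have main : ∀ n : ℕ, a n ≤ K * ((n:ℝ)+1) ^ (-(5/4) : ℝ) := by
    intro n
    induction n using Nat.strong_induction_on with
    | _ n ih =>
    by_cases hn : n < N + 1
    · have h1 : a n * ((n:ℝ)+1) ^ ((5/4) : ℝ) ≤ K :=
        Finset.single_le_sum (f := fun m : ℕ => a m * ((m:ℝ)+1) ^ ((5/4) : ℝ))
          (fun m _ => mul_nonneg (ha m) (by positivity)) (Finset.mem_range.2 hn)
      rw [Real.rpow_neg (by positivity), ← div_eq_mul_inv, le_div_iff₀ (by positivity)]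
      exact h1
    · obtain ⟨n, rfl⟩ : ∃ m, n = m + 1 := ⟨n - 1, by omega⟩
      have h1 := key n K hK0 fun m hm => ih m (by omega)
      refine h1.trans ?_
      have h2 := hN n (by omega)
      have hn : (0:ℝ) < (n:ℝ) + 1 := by positivity
      push_cast
      have h3 : (2 * ((n:ℝ) + 1)) ^ (-(5/4) : ℝ) ≤ ((n:ℝ) + 1 + 1) ^ (-(5/4) : ℝ) :=
        Real.rpow_le_rpow_of_nonpos (by positivity) (by linarith) (by norm_num)
      rw [Real.mul_rpow (by norm_num) hn.le] at h3
      have h4 : (1/4 : ℝ) ≤ (2:ℝ) ^ (-(5/4) : ℝ) := by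
        calc (1/4 : ℝ) = 2 ^ (-2 : ℝ) := by
              rw [Real.rpow_neg (by norm_num)]; norm_num
          _ ≤ _ := Real.rpow_le_rpow_of_exponent_le (by norm_num) (by norm_num)
      have h5 : ((n:ℝ)+1) ^ (-(5/4) : ℝ) = ((n:ℝ)+1) ^ ((1/4) : ℝ) * ((n:ℝ)+1) ^ (-(3/2) : ℝ) := by
        rw [← Real.rpow_add hn]; norm_num
      calc M * K * ((n:ℝ)+1) ^ (-(3/2) : ℝ) = K * (1/4 * (4 * M * ((n:ℝ)+1) ^ (-(3/2) : ℝ))) := by ring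
        _ ≤ K * (1/4 * (((n:ℝ)+1) ^ ((1/4) : ℝ) * ((n:ℝ)+1) ^ (-(3/2) : ℝ))) := by gcongr
        _ = K * (1/4 * ((n:ℝ)+1) ^ (-(5/4) : ℝ)) := by rw [h5]
        _ ≤ K * (2 ^ (-(5/4) : ℝ) * ((n:ℝ)+1) ^ (-(5/4) : ℝ)) := by gcongr
        _ ≤ _ := by gcongr
  exact ⟨M * K, fun n => key n K hK0 fun m _ => main m⟩

/-- Fejer kernel -/
noncomputable def fej (δ x : ℝ) : ℝ := ∫ w in (0:ℝ)..δ, (δ - w) * Real.cos (w * x)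

lemma fej_mul (δ x : ℝ) : x ^ 2 * fej δ x = 1 - Real.cos (δ * x) := by
  have hd : ∀ w ∈ Set.uIcc (0:ℝ) δ, HasDerivAt
      (fun w => (δ - w) * Real.sin (w * x) * x - Real.cos (w * x))
      (x ^ 2 * ((δ - w) * Real.cos (w * x))) w := by
    intro w _
    have h1 : HasDerivAt (fun w : ℝ => w * x) x w := by simpa using (hasDerivAt_id w).mul_const x
    have h2 : HasDerivAt (fun w : ℝ => δ - w) (-1) w := by simpa using (hasDerivAt_id w).const_sub δ
    have := ((h2.mul h1.sin).mul_const x).sub h1.cos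
    refine this.congr_deriv ?_
    ring
  have := intervalIntegral.integral_eq_sub_of_hasDerivAt hd
    (Continuous.intervalIntegrable (by fun_prop) _ _)
  rw [fej, ← intervalIntegral.integral_const_mul, this]
  simp
  ring

lemma fej_nonneg {δ : ℝ} (hδ : 0 ≤ δ) (x : ℝ) : 0 ≤ fej δ x := by
  rcases eq_or_ne x 0 with rfl | hx
  · unfold fej
    refine intervalIntegral.integral_nonneg hδ fun w hw => ?_
    simp [hw.2]
  · have h := fej_mul δ x
    have : 0 < x ^ 2 := by positivity
    have h2 := Real.cos_le_one (δ * x)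
    by_contra hc
    push Not at hc
    nlinarith

lemma fej_lower {δ : ℝ} (hδ : 0 < δ) (x : ℝ) :
    2 ≤ (2 * x ^ 2 + 2 * (Real.pi / δ) ^ 2) * (fej δ x + fej δ (x + Real.pi / δ)) := by
  have h1 := fej_mul δ x
  have h2 := fej_mul δ (x + Real.pi / δ)
  have h3 : Real.cos (δ * (x + Real.pi / δ)) = - Real.cos (δ * x) := by
    rw [mul_add, mul_div_cancel₀ _ hδ.ne', Real.cos_add_pi]
  rw [h3] at h2
  have n1 := fej_nonneg hδ.le x
  have n2 := fej_nonneg hδ.le (x + Real.pi / δ)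
  have e1 : x ^ 2 * fej δ x ≤ (2 * x ^ 2 + 2 * (Real.pi / δ) ^ 2) * fej δ x := by
    gcongr; nlinarith [sq_nonneg x, sq_nonneg (Real.pi / δ)]
  have e2 : (x + Real.pi / δ) ^ 2 * fej δ (x + Real.pi / δ) ≤
      (2 * x ^ 2 + 2 * (Real.pi / δ) ^ 2) * fej δ (x + Real.pi / δ) := by
    gcongr; nlinarith [sq_nonneg (x - Real.pi / δ)]
  linarith

lemma fej_cont_aux (δ z : ℝ) (μ : Measure ℝ) [IsFiniteMeasure μ] :
    Integrable (Function.uncurry fun (w x : ℝ) => (δ - w) * Real.cos (w * (x + z)))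
      ((volume.restrict (Set.uIoc 0 δ)).prod μ) := by
  have h1 : Integrable (fun w : ℝ => δ - w) (volume.restrict (Set.uIoc 0 δ)) := by
    rw [← IntegrableOn, ← intervalIntegrable_iff]
    exact Continuous.intervalIntegrable (by fun_prop) _ _
  have h2 : Integrable (fun p : ℝ × ℝ => (δ - p.1) * 1) ((volume.restrict (Set.uIoc 0 δ)).prod μ) :=
    Integrable.mul_prod (f := fun w : ℝ => δ - w) (g := fun _ => (1:ℝ)) h1 (integrable_const _)
  refine h2.mono (by fun_prop) (ae_of_all _ fun p => ?_)
  simp only [Function.uncurry, norm_mul]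
  gcongr
  simpa using Real.abs_cos_le_one _

lemma fej_integrable {δ : ℝ} (hδ : 0 ≤ δ) (z : ℝ) (μ : Measure ℝ) [IsFiniteMeasure μ] :
    Integrable (fun x => fej δ (x + z)) μ := by
  have := (fej_cont_aux δ z μ).integral_prod_right
  simpa [fej, intervalIntegral, Function.uncurry, hδ, Set.uIoc_of_le] using this

lemma cos_charFun (μ : Measure ℝ) [IsFiniteMeasure μ] (w z : ℝ) :
    |∫ x, Real.cos (w * (x + z)) ∂μ| ≤ ‖charFun μ w‖ := by
  have h1 : ∫ x, Real.cos (w * (x + z)) ∂μ =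
      (∫ x, Complex.exp (w * x * Complex.I) * Complex.exp (w * z * Complex.I) ∂μ).re := by
    have hi : Integrable (fun x : ℝ => Complex.exp (w * x * Complex.I) * Complex.exp (w * z * Complex.I)) μ := by
      refine Integrable.mul_const ?_ _
      refine Integrable.of_bound (C := 1) (by fun_prop) (ae_of_all _ fun x => ?_)
      have := Complex.norm_exp_ofReal_mul_I (w * x)
      push_cast at this
      exact this.le
    have := integral_re hi
    simp only [RCLike.re_eq_complex_re] at this
    rw [← this]
    congr 1
    funext x
    rw [← Complex.exp_add]
    have := Complex.exp_ofReal_mul_I_re (w * (x + z))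
    rw [← this]
    congr 2
    push_cast
    ring
  rw [h1]
  refine (Complex.abs_re_le_norm _).trans ?_
  rw [integral_mul_const, norm_mul, ← charFun_apply_real]
  have := Complex.norm_exp_ofReal_mul_I (w * z)
  push_cast at this
  rw [this, mul_one]

lemma fej_bound {δ κ N : ℝ} (hδ : 0 < δ) (hκ : 0 < κ * N) (z : ℝ) (μ : Measure ℝ) [IsFiniteMeasure μ]
    (hμ : ∀ w, 0 ≤ w → w ≤ δ → ‖charFun μ w‖ ≤ Real.exp (-(κ * N) * w ^ 2)) :
    ∫ x, fej δ (x + z) ∂μ ≤ δ * √(Real.pi / (κ * N)) := by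
  have h1 : ∫ x, fej δ (x + z) ∂μ =
      ∫ w in (0:ℝ)..δ, ∫ x, (δ - w) * Real.cos (w * (x + z)) ∂μ := by
    unfold fej
    exact (intervalIntegral_integral_swap (fej_cont_aux δ z μ)).symm
  rw [h1]
  have hg : Integrable (fun w : ℝ => δ * Real.exp (-(κ * N) * w ^ 2)) :=
    (integrable_exp_neg_mul_sq hκ).const_mul δ
  calc _ ≤ ∫ w in (0:ℝ)..δ, δ * Real.exp (-(κ * N) * w ^ 2) := by
        refine intervalIntegral.integral_mono_on hδ.le ?_ hg.intervalIntegrable ?_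
        · rw [intervalIntegrable_iff]
          exact (fej_cont_aux δ z μ).integral_prod_left
        · intro w hw
          rw [integral_const_mul]
          have h2 := (le_abs_self _).trans ((cos_charFun μ w z).trans (hμ w hw.1 hw.2))
          calc _ ≤ (δ - w) * Real.exp (-(κ * N) * w ^ 2) :=
                mul_le_mul_of_nonneg_left h2 (by linarith [hw.2])
            _ ≤ _ := by gcongr; linarith [hw.1]
    _ ≤ ∫ w, δ * Real.exp (-(κ * N) * w ^ 2) := by
        rw [intervalIntegral.integral_of_le hδ.le]
        exact setIntegral_le_integral hg (ae_of_all _ fun w => by positivity)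
    _ = _ := by rw [integral_const_mul, integral_gaussian]

lemma exp_fej {δ c : ℝ} (hδ : 0 < δ) (hc : 0 < c) (x : ℝ) :
    Real.exp (-c * |x|) ≤ (2 / c ^ 2 + (Real.pi / δ) ^ 2) *
      (fej δ x + fej δ (x + Real.pi / δ)) := by
  have h1 := fej_lower hδ x
  have hs := add_nonneg (fej_nonneg hδ.le x) (fej_nonneg hδ.le (x + Real.pi / δ))
  set s := fej δ x + fej δ (x + Real.pi / δ)
  have h2 : x ^ 2 * Real.exp (-c * |x|) ≤ 2 / c ^ 2 := by
    have := Real.quadratic_le_exp_of_nonneg (x := c * |x|) (by positivity)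
    rw [neg_mul, Real.exp_neg, ← div_eq_mul_inv, div_le_div_iff₀ (Real.exp_pos _) (by positivity)]
    have e : (c * |x|) ^ 2 = c ^ 2 * x ^ 2 := by rw [mul_pow, sq_abs]
    have : 0 ≤ c * |x| := by positivity
    nlinarith
  have h3 : Real.exp (-c * |x|) ≤ 1 := by
    rw [Real.exp_le_one_iff]; have : 0 ≤ c * |x| := by positivity
    linarith
  have p := Real.exp_pos (-c * |x|)
  calc Real.exp (-c * |x|) = Real.exp (-c * |x|) * 2 / 2 := by ring
    _ ≤ Real.exp (-c * |x|) * ((2 * x ^ 2 + 2 * (Real.pi / δ) ^ 2) * s) / 2 := by gcongr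
    _ = (x ^ 2 * Real.exp (-c * |x|) + Real.exp (-c * |x|) * (Real.pi / δ) ^ 2) * s := by ring
    _ ≤ (2 / c ^ 2 + 1 * (Real.pi / δ) ^ 2) * s := by gcongr
    _ = _ := by ring

lemma exp_bound {δ κ N c : ℝ} (hδ : 0 < δ) (hc : 0 < c) (hκ : 0 < κ * N) (μ : Measure ℝ) [IsFiniteMeasure μ]
    (hμ : ∀ w, 0 ≤ w → w ≤ δ → ‖charFun μ w‖ ≤ Real.exp (-(κ * N) * w ^ 2)) :
    ∫ x, Real.exp (-c * |x|) ∂μ ≤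
      (2 / c ^ 2 + (Real.pi / δ) ^ 2) * (2 * (δ * √(Real.pi / (κ * N)))) := by
  have i1 := fej_integrable hδ.le 0 μ
  simp only [add_zero] at i1
  have i2 := fej_integrable hδ.le (Real.pi / δ) μ
  have b1 := fej_bound hδ hκ 0 μ hμ
  simp only [add_zero] at b1
  have b2 := fej_bound hδ hκ (Real.pi / δ) μ hμ
  calc _ ≤ ∫ x, (2 / c ^ 2 + (Real.pi / δ) ^ 2) * (fej δ x + fej δ (x + Real.pi / δ)) ∂μ := by
        refine integral_mono_of_nonneg (ae_of_all _ fun x => (Real.exp_pos _).le)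
          ((i1.add i2).const_mul _) (ae_of_all _ fun x => exp_fej hδ hc x)
    _ = (2 / c ^ 2 + (Real.pi / δ) ^ 2) * (∫ x, fej δ x ∂μ + ∫ x, fej δ (x + Real.pi / δ) ∂μ) := by
        rw [integral_const_mul, integral_add i1 i2]
    _ ≤ _ := by gcongr; linarith

lemma charFun_small {Ω : Type*} [MeasurableSpace Ω] (μ : Measure Ω) [IsProbabilityMeasure μ]
    (X : Ω → ℝ) (hX : Measurable X) (hL2 : MemLp X 2 μ) (hmean : (∫ ω, X ω ∂μ) = 0)
    (hvar : 0 < variance X μ) :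
    ∃ δ κ : ℝ, 0 < δ ∧ 0 < κ ∧ ∀ w, 0 ≤ w → w ≤ δ →
      ‖charFun (μ.map X) w‖ ≤ Real.exp (-κ * w ^ 2) := by
  have hp : IsProbabilityMeasure (μ.map X) := Measure.isProbabilityMeasure_map hX.aemeasurable
  have hid : MemLp id 2 (μ.map X) := by
    rw [memLp_map_measure_iff (by fun_prop) hX.aemeasurable]; simpa using hL2
  have hT := taylor_isLittleO_univ (f := charFun (μ.map X)) (n := 2) (x₀ := 0)
    (contDiff_charFun (n := 2) hid)
  have hv : variance X μ = ∫ ω, (X ^ 2) ω ∂μ := by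
    rw [variance_eq_sub hL2, hmean]; simp
  set v := variance X μ with hvd
  have hT2 : ∀ t, taylorWithinEval (charFun (μ.map X)) 2 Set.univ 0 t = ((1 - v * t ^ 2 / 2 : ℝ) : ℂ) := by
    intro t
    rw [taylorWithinEval_charFun_two_zero hX.aemeasurable hid, hmean, ← hv]
    push_cast; simp
  simp only [hT2, sub_zero] at hT
  have h1 := hT.bound (c := v / 4) (by positivity)
  have h2 : ∀ᶠ t : ℝ in 𝓝 0, v * t ^ 2 / 2 < 1 := by
    have : Continuous fun t : ℝ => v * t ^ 2 / 2 := by fun_prop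
    exact this.continuousAt.eventually_lt continuousAt_const (by simp)
  obtain ⟨ε, hε, hb⟩ := Metric.eventually_nhds_iff.1 (h1.and h2)
  refine ⟨ε / 2, v / 4, by positivity, by positivity, fun w hw0 hw => ?_⟩
  obtain ⟨k1, k2⟩ := hb (y := w) (by rw [Real.dist_eq, sub_zero, abs_of_nonneg hw0]; linarith)
  have k3 : ‖charFun (μ.map X) w‖ ≤ ‖charFun (μ.map X) w - ((1 - v * w ^ 2 / 2 : ℝ) : ℂ)‖ +
      ‖((1 - v * w ^ 2 / 2 : ℝ) : ℂ)‖ := by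
    have := norm_add_le (charFun (μ.map X) w - ((1 - v * w ^ 2 / 2 : ℝ) : ℂ)) ((1 - v * w ^ 2 / 2 : ℝ) : ℂ)
    simpa using this
  rw [Complex.norm_real, Real.norm_of_nonneg (by linarith)] at k3
  rw [Real.norm_of_nonneg (by positivity)] at k1
  have := Real.add_one_le_exp (-(v / 4) * w ^ 2)
  linarith
end SpW
open MeasureTheory ProbabilityTheory Filter Topology Asymptotics
open scoped ENNReal
namespace SpW

/-- One step of the (minimum, reflected) chain. -/
noncomputable def stp (z : ℝ × ℝ) (x : ℝ) : ℝ × ℝ := (z.1 + min 0 (z.2 + x), max (z.2 + x) 0)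

noncomputable def st (y : ℕ → ℝ) : ℕ → ℝ × ℝ
  | 0 => (0, 0)
  | n + 1 => stp (st y n) (y n)

lemma measurable_stp : Measurable (fun p : (ℝ × ℝ) × ℝ => stp p.1 p.2) := by
  unfold stp; fun_prop

lemma measurable_st (n : ℕ) : Measurable (fun y : ℕ → ℝ => st y n) := by
  induction n with
  | zero => exact measurable_const
  | succ n ih =>
    exact measurable_stp.comp (ih.prodMk (measurable_pi_apply n))

lemma st_congr (y y' : ℕ → ℝ) (n : ℕ) (h : ∀ i < n, y i = y' i) : st y n = st y' n := by
  induction n with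
  | zero => rfl
  | succ n ih =>
    simp only [st]
    rw [ih fun i hi => h i (by omega), h n (by omega)]

lemma st_eq (y : ℕ → ℝ) (n : ℕ) :
    st y n = ((Finset.range (n + 1)).inf' Finset.nonempty_range_add_one
              (fun k => ∑ i ∈ Finset.range k, y i),
      ∑ i ∈ Finset.range n, y i - (Finset.range (n + 1)).inf' Finset.nonempty_range_add_one
              (fun k => ∑ i ∈ Finset.range k, y i)) := by
  induction n with
  | zero => simp [st]
  | succ n ih =>
    have h : (Finset.range (n + 1 + 1)).inf' Finset.nonempty_range_add_one
              (fun k => ∑ i ∈ Finset.range k, y i) =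
        min (∑ i ∈ Finset.range (n+1), y i) ((Finset.range (n + 1)).inf' Finset.nonempty_range_add_one
              (fun k => ∑ i ∈ Finset.range k, y i)) := by
      simp only [Finset.range_add_one (n := n + 1)]
      exact Finset.inf'_insert (Finset.nonempty_range_add_one (n := n))
        (fun k => ∑ i ∈ Finset.range k, y i)
    rw [h, st, ih, Finset.sum_range_succ]
    generalize (Finset.range (n + 1)).inf' Finset.nonempty_range_add_one
              (fun k => ∑ i ∈ Finset.range k, y i) = l
    generalize ∑ i ∈ Finset.range n, y i = s
    simp only [stp]
    rcases le_total (s + y n) l with h | h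
    · rw [min_eq_left h, min_eq_right (by linarith), max_eq_right (by linarith)]
      ext <;> simp
      ring
    · rw [min_eq_right h, min_eq_left (by linarith), max_eq_left (by linarith)]
      ext <;> simp
      ring

lemma indep_st {Ω : Type*} [MeasurableSpace Ω] (μ : Measure Ω) [IsProbabilityMeasure μ]
    (X : ℕ → Ω → ℝ) (hmeas : ∀ i, Measurable (X i)) (hindep : iIndepFun X μ) (n : ℕ) :
    IndepFun (fun ω => st (fun i => X i ω) n) (X n) μ := by
  have h := hindep.indepFun_finset (Finset.range n) {n} (by simp) hmeas
  have hψ : Measurable (fun x : (({n} : Finset ℕ) → ℝ) => x ⟨n, by simp⟩) := measurable_pi_apply _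
  have hφ : Measurable (fun x : (Finset.range n → ℝ) =>
      st (fun i => if h : i ∈ Finset.range n then x ⟨i, h⟩ else 0) n) := by
    refine (measurable_st n).comp (measurable_pi_lambda _ fun i => ?_)
    by_cases hi : i ∈ Finset.range n
    · simp only [hi, dite_true]; exact measurable_pi_apply _
    · simp only [hi, dite_false]; exact measurable_const
  have h2 := h.comp hφ hψ
  convert h2 using 1
  · funext ω
    refine st_congr _ _ _ fun i hi => ?_
    simp [hi]
  · rfl

lemma law_st {Ω : Type*} [MeasurableSpace Ω] (μ : Measure Ω) [IsProbabilityMeasure μ]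
    (X : ℕ → Ω → ℝ) (hmeas : ∀ i, Measurable (X i)) (hindep : iIndepFun X μ)
    (hident : ∀ i, IdentDistrib (X i) (X 0) μ μ) (n : ℕ) :
    ∀ f : ℝ × ℝ → ℝ≥0∞, Measurable f → ∫⁻ ω, f (st (fun i => X i ω) n) ∂μ =
      ∑ p ∈ Finset.HasAntidiagonal.antidiagonal n,
        ∫⁻ l, ∫⁻ d, f (l, d) ∂(vM (μ.map (X 0)) p.2) ∂(uM (μ.map (X 0)) p.1) := by
  have hF : IsProbabilityMeasure (μ.map (X 0)) :=
    Measure.isProbabilityMeasure_map (hmeas 0).aemeasurable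
  have hms : ∀ n, Measurable (fun ω => st (fun i => X i ω) n) := fun n =>
    (measurable_st n).comp (measurable_pi_lambda _ fun i => hmeas i)
  induction n with
  | zero =>
    intro f hf
    simp only [st, Finset.Nat.antidiagonal_zero, Finset.sum_singleton, uM, vM]
    rw [lintegral_dirac' _ (by fun_prop), lintegral_dirac' _ (by fun_prop)]
    simp
  | succ n ih =>
    intro f hf
    set F := μ.map (X 0) with hFd
    have hstp := measurable_stp
    have s1 : ∫⁻ ω, f (st (fun i => X i ω) (n+1)) ∂μ =
        ∫⁻ ω, (∫⁻ x, f (stp (st (fun i => X i ω) n) x) ∂F) ∂μ := by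
      have e1 := (indepFun_iff_map_prod_eq_prod_map_map (hms n).aemeasurable
        (hmeas n).aemeasurable).1 (indep_st μ X hmeas hindep n)
      rw [(hident n).map_eq] at e1
      have e2 : ∫⁻ ω, f (st (fun i => X i ω) (n+1)) ∂μ = ∫⁻ p, f (stp p.1 p.2)
          ∂(μ.map (fun ω => (st (fun i => X i ω) n, X n ω))) := by
        rw [lintegral_map (f := fun p : (ℝ × ℝ) × ℝ => f (stp p.1 p.2)) (hf.comp hstp) ((hms n).prodMk (hmeas n))]
        rfl
      rw [e2, e1, lintegral_prod (fun p : (ℝ × ℝ) × ℝ => f (stp p.1 p.2)) (hf.comp hstp).aemeasurable, lintegral_map _ (hms n)]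
      exact (hf.comp hstp).lintegral_prod_right'
    rw [s1, ih (fun z => ∫⁻ x, f (stp z x) ∂F) ((hf.comp hstp).lintegral_prod_right')]
    have hf0 : Measurable fun l : ℝ => f (l, 0) := by fun_prop
    have s2 : ∀ p : ℕ × ℕ, ∫⁻ l, ∫⁻ d, ∫⁻ x, f (stp (l, d) x) ∂F ∂(vM F p.2) ∂(uM F p.1) =
        ∫⁻ l, f (l, 0) ∂(uM F p.1 ∗ gM F (p.2 + 1)) +
        ∫⁻ l, ∫⁻ d, f (l, d) ∂(vM F (p.2 + 1)) ∂(uM F p.1) := by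
      intro p
      rw [Measure.lintegral_conv hf0, ← lintegral_add_left (by
        exact (Measurable.lintegral_prod_right' (f := fun q : ℝ × ℝ => f (q.1 + q.2, 0)) (by fun_prop)))]
      congr 1
      funext l
      have hk : Measurable fun y : ℝ => f (l + min 0 y, max y 0) := by fun_prop
      have e3 := (Measure.lintegral_conv (μ := vM F p.2) (ν := F) hk).symm
      simp only [stp]
      rw [e3, ← lintegral_add_compl _ (measurableSet_Iic (a := (0:ℝ))), Set.compl_Iic]
      simp only [gM, vM]
      congr 1
      · refine setLIntegral_congr_fun measurableSet_Iic fun y hy => ?_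
        have hy : y ≤ 0 := hy
        simp only [min_eq_right hy, max_eq_right hy]
      · refine setLIntegral_congr_fun measurableSet_Ioi fun y hy => ?_
        have hy : 0 < y := hy
        simp only [min_eq_left hy.le, max_eq_left hy.le, add_zero]
    rw [Finset.sum_congr rfl fun p _ => s2 p, Finset.sum_add_distrib,
      ← lintegral_finsetSum_measure, ← rec_g, Finset.Nat.sum_antidiagonal_succ']
    congr 1
    congr 1
    funext l
    simp only [vM]
    rw [lintegral_dirac' _ (by fun_prop)]

/-- Laplace functional -/
noncomputable def lap (c : ℝ) (m : Measure ℝ) : ℝ≥0∞ := ∫⁻ x, ENNReal.ofReal (Real.exp (c * x)) ∂m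

lemma lap_conv (c : ℝ) (m m' : Measure ℝ) [IsFiniteMeasure m] [IsFiniteMeasure m'] :
    lap c (m ∗ m') = lap c m * lap c m' := by
  unfold lap
  rw [Measure.lintegral_conv (by fun_prop), ← lintegral_mul_const _ (by fun_prop)]
  congr 1
  funext x
  rw [← lintegral_const_mul _ (by fun_prop)]
  congr 1
  funext y
  rw [mul_add, Real.exp_add, ENNReal.ofReal_mul (Real.exp_pos _).le]

lemma lap_rec_u (F : Measure ℝ) [IsFiniteMeasure F] (c : ℝ) (n : ℕ) :
    (n : ℝ≥0∞) * lap c (uM F n) = ∑ p ∈ Finset.HasAntidiagonal.antidiagonal n,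
      lap c (qM F p.1) * lap c (uM F p.2) := by
  have h := congrArg (lap c) (rec_u F n)
  have e : lap c (n • uM F n) = n * lap c (uM F n) := by
    unfold lap; rw [lintegral_smul_measure]; simp
  rw [← e, h]
  conv_lhs => unfold lap
  rw [lintegral_finsetSum_measure]
  exact Finset.sum_congr rfl fun p _ => lap_conv c _ _

lemma lap_rec_v (F : Measure ℝ) [IsFiniteMeasure F] (c : ℝ) (n : ℕ) :
    (n : ℝ≥0∞) * lap c (vM F n) = ∑ p ∈ Finset.HasAntidiagonal.antidiagonal n,
      lap c (pM F p.1) * lap c (vM F p.2) := by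
  have h := congrArg (lap c) (rec_v F n)
  have e : lap c (n • vM F n) = n * lap c (vM F n) := by
    unfold lap; rw [lintegral_smul_measure]; simp
  rw [← e, h]
  conv_lhs => unfold lap
  rw [lintegral_finsetSum_measure]
  exact Finset.sum_congr rfl fun p _ => lap_conv c _ _

open PowerSeries in
lemma abs_rec {R : Type*} [CommSemiring R] (u v q p : ℕ → R) (hq : q 0 = 0) (hp : p 0 = 0)
    (hu : ∀ n : ℕ, (n : R) * u n = ∑ i ∈ Finset.HasAntidiagonal.antidiagonal n, q i.1 * u i.2)
    (hv : ∀ n : ℕ, (n : R) * v n = ∑ i ∈ Finset.HasAntidiagonal.antidiagonal n, p i.1 * v i.2)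
    (a : ℕ → R) (ha : ∀ n, a n = ∑ i ∈ Finset.HasAntidiagonal.antidiagonal n, u i.1 * v i.2)
    (n : ℕ) : ((n : R) + 1) * a (n+1) = ∑ k ∈ Finset.range (n+1), (q (k+1) + p (k+1)) * a (n - k) := by
  have key : ∀ (u q : ℕ → R), (∀ n : ℕ, (n : R) * u n =
      ∑ i ∈ Finset.HasAntidiagonal.antidiagonal n, q i.1 * u i.2) →
      X * derivative R (mk u) = mk q * mk u := by
    intro u q h
    ext n
    rw [coeff_mul _ (mk q)]
    simp only [coeff_mk]
    rw [← h]
    cases n with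
    | zero => simp
    | succ n => simp [coeff_succ_X_mul, coeff_derivative, mul_comm]
  have h1 := key u q hu
  have h2 := key v p hv
  have h3 : mk u * mk v = mk a := by
    ext n; rw [coeff_mul]; simp [ha]
  have h4 : X * derivative R (mk a) = mk (fun k => q k + p k) * mk a := by
    have : mk (fun k => q k + p k) = mk q + mk p := by ext; simp
    rw [this, ← h3, Derivation.leibniz, smul_eq_mul, smul_eq_mul, mul_add, mul_left_comm, h2,
      mul_left_comm X, h1]
    ring
  have h5 := congrArg (coeff (n+1)) h4
  rw [coeff_mul _ (mk _), coeff_succ_X_mul, coeff_derivative, Finset.Nat.sum_antidiagonal_succ] at h5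
  simp only [coeff_mk, hq, hp, add_zero, zero_mul, zero_add] at h5
  rw [mul_comm, h5, Finset.Nat.sum_antidiagonal_eq_sum_range_succ (fun i j => (q (i+1) + p (i+1)) * a j)]

lemma charFun_FM (F : Measure ℝ) [IsFiniteMeasure F] (n : ℕ) (t : ℝ) :
    charFun (FM F n) t = charFun F t ^ n := by
  induction n with
  | zero => simp [FM]
  | succ n ih => rw [FM, charFun_conv, ih, pow_succ]

instance (F : Measure ℝ) [IsProbabilityMeasure F] (n : ℕ) : IsProbabilityMeasure (FM F n) := by
  induction n with
  | zero => unfold FM; infer_instance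
  | succ n ih => unfold FM; infer_instance

lemma b_bound (F : Measure ℝ) [IsProbabilityMeasure F] (δ κ η : ℝ) (hδ : 0 < δ) (hκ : 0 < κ)
    (hη : 0 < η)
    (hF : ∀ w, 0 ≤ w → w ≤ δ → ‖charFun F w‖ ≤ Real.exp (-κ * w ^ 2)) :
    ∃ C : ℝ, 0 ≤ C ∧ ∀ k : ℕ, lap η (qM F (k+1)) + lap (-1) (pM F (k+1)) ≤
      ENNReal.ofReal (C * ((k:ℝ)+1) ^ (-(1/2) : ℝ)) := by
  set c := min 1 η with hc
  have hc0 : 0 < c := by rw [hc]; positivity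
  refine ⟨(2 / c ^ 2 + (Real.pi / δ) ^ 2) * (2 * (δ * √(Real.pi / κ))), by positivity, fun k => ?_⟩
  have h1 : lap η (qM F (k+1)) + lap (-1) (pM F (k+1)) ≤
      ∫⁻ x, ENNReal.ofReal (Real.exp (-c * |x|)) ∂(FM F (k+1)) := by
    rw [← lintegral_add_compl _ (measurableSet_Iic (a := (0:ℝ))), Set.compl_Iic]
    unfold lap qM pM
    refine add_le_add (setLIntegral_mono (by fun_prop) fun x hx => ?_)
      (setLIntegral_mono (by fun_prop) fun x hx => ?_)
    · have hx : x ≤ 0 := hx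
      refine ENNReal.ofReal_le_ofReal (Real.exp_le_exp.2 ?_)
      rw [abs_of_nonpos hx]
      nlinarith [min_le_right 1 η]
    · have hx : 0 < x := hx
      refine ENNReal.ofReal_le_ofReal (Real.exp_le_exp.2 ?_)
      rw [abs_of_pos hx]
      nlinarith [min_le_left 1 η]
  refine h1.trans ?_
  have hk : (0:ℝ) < (k:ℝ) + 1 := by positivity
  rw [← ofReal_integral_eq_lintegral_ofReal]
  · refine ENNReal.ofReal_le_ofReal ?_
    refine (exp_bound (κ := κ) (N := (k:ℝ)+1) hδ hc0 (by positivity) (FM F (k+1)) ?_).trans (le_of_eq ?_)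
    · intro w h0 hw
      rw [charFun_FM, norm_pow]
      calc _ ≤ (Real.exp (-κ * w ^ 2)) ^ (k+1) := by gcongr; exact hF w h0 hw
        _ = _ := by rw [← Real.exp_nat_mul]; push_cast; ring_nf
    · rw [← div_div, Real.sqrt_div (by positivity), Real.rpow_neg hk.le, ← Real.sqrt_eq_rpow]
      ring
  · refine Integrable.of_bound (C := 1) (by fun_prop) (ae_of_all _ fun x => ?_)
    rw [Real.norm_of_nonneg (Real.exp_pos _).le, Real.exp_le_one_iff]
    have : 0 ≤ c * |x| := by positivity
    linarith
  · exact ae_of_all _ fun x => (Real.exp_pos _).le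

end SpW
open SpW

/-- Corollary 5.5. For an i.i.d. centered random walk with finite
positive variance, for every `θ > 1` one has `E[e^{-Sₙ + θ Lₙ⁻}] = O(n^{-3/2})`, where
`Lₙ⁻ = min(0, S₁, …, Sₙ)`. -/
theorem stmt12 {Ω : Type*} [MeasurableSpace Ω] (μ : Measure Ω) [IsProbabilityMeasure μ]
    (X : ℕ → Ω → ℝ) (hmeas : ∀ i, Measurable (X i))
    (hindep : iIndepFun X μ)
    (hident : ∀ i, IdentDistrib (X i) (X 0) μ μ)
    (hL2 : MemLp (X 0) 2 μ)
    (hmean : (∫ ω, X 0 ω ∂μ) = 0)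
    (hvar : 0 < variance (X 0) μ)
    (θ : ℝ) (hθ : 1 < θ) :
    (fun n : ℕ => ∫ ω, Real.exp (-(∑ i ∈ Finset.range n, X i ω)
          + θ * (Finset.range (n + 1)).inf' Finset.nonempty_range_add_one
              (fun k => ∑ i ∈ Finset.range k, X i ω)) ∂μ)
      =O[atTop] fun n : ℕ => (n : ℝ) ^ (-(3 : ℝ) / 2) := by
  have hF : IsProbabilityMeasure (μ.map (X 0)) :=
    Measure.isProbabilityMeasure_map (hmeas 0).aemeasurable
  obtain ⟨δ, κ, hδ, hκ, hcf⟩ := charFun_small μ (X 0) (hmeas 0) hL2 hmean hvar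
  set F := μ.map (X 0) with hFd
  obtain ⟨C, hC, hb⟩ := b_bound F δ κ (θ - 1) hδ hκ (by linarith) hcf
  have hms : ∀ n, Measurable (fun ω => st (fun i => X i ω) n) := fun n =>
    (measurable_st n).comp (measurable_pi_lambda _ fun i => hmeas i)
  -- the exponent through the chain
  have hE : ∀ (n : ℕ) ω, -(∑ i ∈ Finset.range n, X i ω)
          + θ * (Finset.range (n + 1)).inf' Finset.nonempty_range_add_one
              (fun k => ∑ i ∈ Finset.range k, X i ω) =
      (θ - 1) * (st (fun i => X i ω) n).1 + (-1) * (st (fun i => X i ω) n).2 := by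
    intro n ω
    rw [st_eq]
    ring
  set a : ℕ → ℝ≥0∞ := fun n => ∫⁻ ω, ENNReal.ofReal (Real.exp
    ((θ - 1) * (st (fun i => X i ω) n).1 + (-1) * (st (fun i => X i ω) n).2)) ∂μ with had
  have ha : ∀ n, a n = ∑ i ∈ Finset.HasAntidiagonal.antidiagonal n,
      lap (θ - 1) (uM F i.1) * lap (-1) (vM F i.2) := by
    intro n
    have := law_st μ X hmeas hindep hident n (fun z => ENNReal.ofReal (Real.exp
      ((θ - 1) * z.1 + (-1) * z.2))) (by fun_prop)
    rw [had]
    simp only at this ⊢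
    rw [this]
    refine Finset.sum_congr rfl fun p _ => ?_
    unfold lap
    rw [← lintegral_mul_const _ (by fun_prop)]
    congr 1
    funext x
    rw [← lintegral_const_mul _ (by fun_prop)]
    congr 1
    funext y
    rw [Real.exp_add, ENNReal.ofReal_mul (Real.exp_pos _).le]
  have hrec := abs_rec (fun n => lap (θ - 1) (uM F n)) (fun n => lap (-1) (vM F n))
    (fun n => lap (θ - 1) (qM F n)) (fun n => lap (-1) (pM F n)) (by simp [lap, qM])
    (by simp [lap, pM]) (lap_rec_u F _) (lap_rec_v F _) a ha
  have hst : ∀ (y : ℕ → ℝ) n, (st y n).1 ≤ 0 ∧ 0 ≤ (st y n).2 := by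
    intro y n
    induction n with
    | zero => simp [st]
    | succ n ih =>
      simp only [st, stp]
      exact ⟨by linarith [min_le_left 0 ((st y n).2 + y n), ih.1], le_max_right _ _⟩
  have ha1 : ∀ n, a n ≠ ∞ := by
    intro n
    refine ne_top_of_le_ne_top ENNReal.one_ne_top ?_
    calc a n ≤ ∫⁻ ω, 1 ∂μ := by
          refine lintegral_mono fun ω => ?_
          rw [ENNReal.ofReal_le_one, Real.exp_le_one_iff]
          have := hst (fun i => X i ω) n
          nlinarith
      _ = 1 := by simp
  have hb1 : ∀ k, lap (θ - 1) (qM F (k+1)) + lap (-1) (pM F (k+1)) ≠ ∞ := fun k =>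
    ne_top_of_le_ne_top ENNReal.ofReal_ne_top (hb k)
  obtain ⟨K, hK⟩ := seq_bound (fun n => (a n).toReal)
    (fun k => (lap (θ - 1) (qM F k) + lap (-1) (pM F k)).toReal) C
    (fun n => ENNReal.toReal_nonneg)
    (fun k => ENNReal.toReal_le_of_le_ofReal (by positivity) (hb k)) hC (by
      intro n
      have h := congrArg ENNReal.toReal (hrec n)
      rw [ENNReal.toReal_mul, ENNReal.toReal_sum fun k _ => ENNReal.mul_ne_top (hb1 k) (ha1 _)] at h
      simp only [ENNReal.toReal_mul] at h
      rw [← h]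
      congr 1)
  have hI : ∀ n : ℕ, ∫ ω, Real.exp (-(∑ i ∈ Finset.range n, X i ω)
          + θ * (Finset.range (n + 1)).inf' Finset.nonempty_range_add_one
              (fun k => ∑ i ∈ Finset.range k, X i ω)) ∂μ = (a n).toReal := by
    intro n
    simp only [hE]
    rw [integral_eq_lintegral_of_nonneg_ae (ae_of_all _ fun ω => (Real.exp_pos _).le)]
    have := hms n
    exact Measurable.aestronglyMeasurable (by fun_prop)
  simp only [hI]
  refine IsBigO.of_bound K (eventually_atTop.2 ⟨1, fun n hn => ?_⟩)
  obtain ⟨m, rfl⟩ : ∃ m, n = m + 1 := ⟨n - 1, by omega⟩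
  rw [Real.norm_of_nonneg ENNReal.toReal_nonneg, Real.norm_of_nonneg (by positivity)]
  have := hK m
  rw [neg_div]
  push_cast
  exact this
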